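/- arXiv:2508.04054 — 7 statements merged into one kernel-verified Lean document; each statement's English description precedes it below -/
import Mathlib

section
/- For all natural numbers r, i and j one has binom(r,i)·binom(r,j) = ∑_{l=0}^{i+j} binom(l,i)·binom(i, i+j−l)·binom(r,l). -/
/-- For all natural numbers `r`, `i`, `j` one has
`binom(r,i)·binom(r,j) = ∑_{l=0}^{i+j} binom(l,i)·binom(i, i+j−l)·binom(r,l)`. -/
theorem choose_mul_choose_eq_sum (r i j : ℕ) :
    r.choose i * r.choose j =
      ∑ l ∈ Finset.range (i + j + 1),
        l.choose i * i.choose (i + j - l) * r.choose l := by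
  have h_low : ∑ l ∈ Finset.range i, l.choose i * i.choose (i + j - l) * r.choose l = 0 :=
    Finset.sum_eq_zero fun l hl => by
      rw [Nat.choose_eq_zero_of_lt (Finset.mem_range.mp hl), zero_mul, zero_mul]
  have h_high (a : ℕ) : (i + a).choose i * i.choose (i + j - (i + a)) * r.choose (i + a) =
      r.choose i * ((r - i).choose a * i.choose (j - a)) := by
    have h := Nat.choose_mul (n := r) (Nat.le_add_right i a)
    rw [Nat.add_sub_cancel_left] at h
    rw [Nat.add_sub_add_left, ← mul_assoc, ← h]
    ring
  rw [add_assoc, Finset.sum_range_add, h_low, zero_add]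
  simp_rw [h_high]
  rw [← Finset.mul_sum]
  rcases lt_or_ge r i with hri | hir
  · simp [Nat.choose_eq_zero_of_lt hri]
  · rw [← Finset.Nat.sum_antidiagonal_eq_sum_range_succ
      (fun a b => (r - i).choose a * i.choose b), ← Nat.add_choose_eq, Nat.sub_add_cancel hir]
end

section
/- Define rational numbers α(j,i) for natural numbers i,j by α(j,i) = ((j−2c+1)/(j−c+1))·binom(j,c) with c = (j−i)/2 whenever i ≤ j and j ≡ i (mod 2), and α(j,i) = 0 otherwise; define τ(k,j) = (−1)^{(j−k)/2}·binom((k+j)/2, k) whenever k ≤ j and j ≡ k (mod 2), and τ(k,j) = 0 otherwise. Then for all natural numbers i and j, ∑_{k=i}^{j} α(k,i)·τ(k,j) equals 1 if i = j and 0 otherwise; that is, the infinite unitriangular matrix S with entries S_{i,k} = α(k,i) has inverse given by τ. -/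
open Finset

/-- The character value `χ_{S_i}(j)` of the cell module `S_i` of the Temperley–Lieb
monoid at the `J`-class with `j` through strands: with `c = (j-i)/2`, it is
`((j−2c+1)/(j−c+1))·binom(j,c)` when `i ≤ j` and `j ≡ i (mod 2)`, and `0` otherwise. -/
noncomputable def tlAlpha (j i : ℕ) : ℚ :=
  if i ≤ j ∧ j % 2 = i % 2 then
    (((j : ℚ) - 2 * ((j - i) / 2 : ℕ) + 1) / ((j : ℚ) - ((j - i) / 2 : ℕ) + 1)) *
      (j.choose ((j - i) / 2))
  else 0

/-- `τ(k,j) = (−1)^{(j−k)/2}·binom((k+j)/2, k)` when `k ≤ j` and `j ≡ k (mod 2)`,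
and `0` otherwise; this is the coefficient of `x^{(j−k)/2}` in `(1+x)^{−(k+1)}`. -/
noncomputable def tlTau (k j : ℕ) : ℚ :=
  if k ≤ j ∧ j % 2 = k % 2 then
    (-1 : ℚ) ^ ((j - k) / 2) * (((k + j) / 2).choose k)
  else 0

theorem tlAlpha_add_two_mul (i c : ℕ) :
    tlAlpha (i + 2 * c) i = ((i : ℚ) + 1) / (i + c + 1) * ((i + 2 * c).choose c) := by
  have h : (i + 2 * c - i) / 2 = c := by omega
  rw [tlAlpha, if_pos (by omega), h]
  push_cast
  congr 2 <;> ring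

theorem tlAlpha_self (i : ℕ) : tlAlpha i i = 1 := by
  have h := tlAlpha_add_two_mul i 0
  have h' : (i : ℚ) + 1 ≠ 0 := by positivity
  simpa [h'] using h

theorem tlAlpha_of_not {j i : ℕ} (h : ¬(i ≤ j ∧ j % 2 = i % 2)) : tlAlpha j i = 0 :=
  if_neg h

theorem tlTau_add_two_mul (k c : ℕ) :
    tlTau k (k + 2 * c) = (-1) ^ c * ((k + c).choose k) := by
  have h : (k + 2 * c - k) / 2 = c := by omega
  have h' : (k + (k + 2 * c)) / 2 = k + c := by omega
  rw [tlTau, if_pos (by omega), h, h']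

theorem tlTau_self (k : ℕ) : tlTau k k = 1 := by
  simpa using tlTau_add_two_mul k 0

theorem tlTau_of_not {k j : ℕ} (h : ¬(k ≤ j ∧ j % 2 = k % 2)) : tlTau k j = 0 :=
  if_neg h

theorem tlAlpha_succ_zero (k : ℕ) : tlAlpha (k + 1) 0 = tlAlpha k 1 := by
  by_cases h : 1 ≤ k ∧ k % 2 = 1 % 2
  · obtain ⟨c, rfl⟩ : ∃ c, k = 1 + 2 * c := ⟨(k - 1) / 2, by omega⟩
    have hs : (1 + 2 * c).choose (c + 1) = (1 + 2 * c).choose c :=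
      Nat.choose_symm_of_eq_add (by ring)
    have e : 1 + 2 * c + 1 = 0 + 2 * (c + 1) := by ring
    rw [tlAlpha_add_two_mul, e, tlAlpha_add_two_mul, ← e, Nat.choose_succ_succ, hs]
    push_cast
    field_simp
    ring
  · rw [tlAlpha_of_not h, tlAlpha_of_not (by omega)]

theorem tlAlpha_succ_succ (k i : ℕ) :
    tlAlpha (k + 1) (i + 1) = tlAlpha k i + tlAlpha k (i + 2) := by
  by_cases h : i ≤ k ∧ k % 2 = i % 2
  · obtain ⟨c, rfl⟩ : ∃ c, k = i + 2 * c := ⟨(k - i) / 2, by omega⟩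
    cases c with
    | zero => simp [tlAlpha_self, tlAlpha_of_not (j := i) (i := i + 2) (by omega)]
    | succ c =>
      have hp := Nat.choose_succ_succ (i + 2 * (c + 1)) c
      have hr := Nat.choose_succ_right_eq (i + 2 * (c + 1)) c
      have hsub : i + 2 * (c + 1) - c = i + c + 2 := by omega
      rw [hsub] at hr
      have e₁ : i + 2 * (c + 1) + 1 = i + 1 + 2 * (c + 1) := by ring
      have e₂ : i + 2 * (c + 1) = i + 2 + 2 * c := by ring
      have hα := tlAlpha_add_two_mul (i + 2) c
      rw [← e₂] at hα
      rw [hα, tlAlpha_add_two_mul, e₁, tlAlpha_add_two_mul, ← e₁, hp]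
      have hq : ((i + 2 * (c + 1)).choose (c + 1) : ℚ)
          = (i + 2 * (c + 1)).choose c * (i + c + 2) / (c + 1) := by
        rw [eq_div_iff (by positivity)]
        exact_mod_cast hr
      push_cast
      rw [hq]
      field_simp
      ring
  · rw [tlAlpha_of_not h, tlAlpha_of_not (by omega), tlAlpha_of_not (by omega), add_zero]

theorem tlTau_zero_add_two (j : ℕ) : tlTau 0 (j + 2) = -tlTau 0 j := by
  by_cases h : 0 ≤ j ∧ j % 2 = 0 % 2
  · obtain ⟨c, rfl⟩ : ∃ c, j = 0 + 2 * c := ⟨j / 2, by omega⟩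
    rw [tlTau_add_two_mul, show 0 + 2 * c + 2 = 0 + 2 * (c + 1) by ring, tlTau_add_two_mul]
    simp [pow_succ]
  · rw [tlTau_of_not h, tlTau_of_not (by omega), neg_zero]

theorem tlTau_succ_add_two (k j : ℕ) :
    tlTau (k + 1) (j + 2) = tlTau k (j + 1) - tlTau (k + 1) j := by
  by_cases h : k ≤ j + 1 ∧ (j + 1) % 2 = k % 2
  · obtain ⟨c, hc⟩ : ∃ c, j + 1 = k + 2 * c := ⟨(j + 1 - k) / 2, by omega⟩
    cases c with
    | zero =>
      obtain rfl : k = j + 1 := by omega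
      simp [tlTau_self, tlTau_of_not (k := j + 1 + 1) (j := j) (by omega)]
    | succ c =>
      obtain rfl : j = k + 1 + 2 * c := by omega
      rw [tlTau_add_two_mul, hc, tlTau_add_two_mul,
        show k + 1 + 2 * c + 2 = k + 1 + 2 * (c + 1) by ring, tlTau_add_two_mul,
        show k + 1 + (c + 1) = k + (c + 1) + 1 by ring, Nat.choose_succ_succ,
        show k + 1 + c = k + (c + 1) by ring]
      push_cast
      ring
  · rw [tlTau_of_not h, tlTau_of_not (by omega), tlTau_of_not (by omega), sub_zero]

/-- The three-term recurrence for `tlTau`, summed against an arbitrary sequence. -/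
theorem sum_mul_tlTau_add_two (f : ℕ → ℚ) (j : ℕ) :
    ∑ k ∈ range (j + 3), f k * tlTau k (j + 2)
      = ∑ k ∈ range (j + 2), f (k + 1) * tlTau k (j + 1)
        - ∑ k ∈ range (j + 1), f k * tlTau k j := by
  have hj : ∑ k ∈ range (j + 1), f k * tlTau k j = ∑ k ∈ range (j + 3), f k * tlTau k j := by
    rw [sum_range_succ _ (j + 2), sum_range_succ _ (j + 1),
      tlTau_of_not (k := j + 2) (by omega), tlTau_of_not (k := j + 1) (by omega)]
    ring
  rw [hj, sum_range_succ', sum_range_succ' _ (j + 2), tlTau_zero_add_two]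
  simp only [tlTau_succ_add_two, mul_sub, sum_sub_distrib]
  ring

theorem sum_range_tlAlpha_mul_tlTau (i j : ℕ) :
    ∑ k ∈ range (j + 1), tlAlpha k i * tlTau k j = if i = j then 1 else 0 := by
  induction j using Nat.twoStepInduction generalizing i with
  | zero =>
    rcases i with _ | i
    · simp [tlAlpha_self, tlTau_self]
    · simp [tlAlpha_of_not (j := 0) (i := i + 1) (by omega)]
  | one =>
    rw [sum_range_succ, sum_range_one, tlTau_of_not (k := 0) (by omega), tlTau_self]
    rcases eq_or_ne i 1 with rfl | hi
    · simp [tlAlpha_self]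
    · simp [tlAlpha_of_not (j := 1) (i := i) (by omega), hi]
  | more j ih₀ ih₁ =>
    rw [sum_mul_tlTau_add_two, ih₀]
    cases i with
    | zero =>
      simp only [tlAlpha_succ_zero, ih₁]
      grind
    | succ i =>
      simp only [tlAlpha_succ_succ, add_mul, sum_add_distrib, ih₁]
      grind

/-- The infinite unitriangular matrix `S` with entries `S_{i,k} = α(k,i)` has inverse
given by `τ`: for all natural numbers `i` and `j`,
`∑_{k=i}^{j} α(k,i)·τ(k,j)` equals `1` if `i = j` and `0` otherwise. -/
theorem tlAlpha_mul_tlTau_sum (i j : ℕ) :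
    ∑ k ∈ Finset.Icc i j, tlAlpha k i * tlTau k j = if i = j then 1 else 0 := by
  rw [← sum_range_tlAlpha_mul_tlTau]
  refine sum_subset (fun k hk => ?_) fun k hk hk' => ?_
  · simp only [mem_Icc, mem_range] at hk ⊢
    omega
  · simp only [mem_Icc, mem_range] at hk hk'
    rw [tlAlpha_of_not (by omega), zero_mul]
end

section
/- Define rational numbers β(j,i) for natural numbers i,j by β(j,i) = ∑_{t=0}^{j} ((i+1)/(i+t+1))·binom(j, i+2t)·binom(i+2t, t) whenever i ≤ j, and β(j,i) = 0 otherwise; define μ(k,j) = (−1)^{j−k}·∑_{r=0}^{⌊(j−k)/2⌋} (−1)^r·binom(k+r, r)·binom(j−r, j−k−2r) whenever k ≤ j, and μ(k,j) = 0 otherwise. Then for all natural numbers i and j, ∑_{k=i}^{j} β(k,i)·μ(k,j) equals 1 if i = j and 0 otherwise; that is, the infinite unitriangular matrix S with entries S_{i,k} = β(k,i) has inverse given by μ. -/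
open Finset

/-- The character value `χ_{S_i}(j)` of the cell module `S_i` of the Motzkin monoid
at the `J`-class with `j` through strands:
`β(j,i) = ∑_{t=0}^{j} ((i+1)/(i+t+1))·binom(j, i+2t)·binom(i+2t, t)` when `i ≤ j`,
and `0` otherwise. -/
noncomputable def moBeta (j i : ℕ) : ℚ :=
  if i ≤ j then
    ∑ t ∈ Finset.range (j + 1),
      (((i : ℚ) + 1) / ((i : ℚ) + (t : ℚ) + 1)) * (j.choose (i + 2 * t)) *
        ((i + 2 * t).choose t)
  else 0

/-- `μ(k,j) = (−1)^{j−k}·∑_{r=0}^{⌊(j−k)/2⌋} (−1)^r·binom(k+r, r)·binom(j−r, j−k−2r)`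
when `k ≤ j`, and `0` otherwise; this is the coefficient of `x^{j−k}` in
`(1+x+x²)^{−(k+1)}`. -/
noncomputable def moMu (k j : ℕ) : ℚ :=
  if k ≤ j then
    (-1 : ℚ) ^ (j - k) *
      ∑ r ∈ Finset.range ((j - k) / 2 + 1),
        (-1 : ℚ) ^ r * ((k + r).choose r) * ((j - r).choose (j - k - 2 * r))
  else 0

/-- The ballot number `(i+1)/(i+t+1)·binom(i+2t, t)`. -/
noncomputable def ballot (i t : ℕ) : ℚ :=
  ((i : ℚ) + 1) / ((i : ℚ) + (t : ℚ) + 1) * ((i + 2 * t).choose t)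

lemma ballot_zero_right (i : ℕ) : ballot i 0 = 1 := by
  have : (i : ℚ) + 1 ≠ 0 := by positivity
  simp [ballot, this]

lemma choose_succ_mul_succ (i t : ℕ) :
    ((i + 2 * t + 1).choose (t + 1) : ℚ) * (t + 1)
      = ((i + 2 * t + 1).choose t : ℚ) * (i + t + 1) := by
  have h := Nat.choose_succ_right_eq (i + 2 * t + 1) t
  rw [show i + 2 * t + 1 - t = i + t + 1 by omega] at h
  exact_mod_cast h

lemma ballot_zero_succ (t : ℕ) : ballot 0 (t + 1) = ballot 1 t := by
  have h := choose_succ_mul_succ 0 t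
  have hp : ((0 + 2 * (t + 1)).choose (t + 1) : ℚ)
      = ((0 + 2 * t + 1).choose t : ℚ) + ((0 + 2 * t + 1).choose (t + 1) : ℚ) := by
    rw [show 0 + 2 * (t + 1) = (0 + 2 * t + 1) + 1 by ring, Nat.choose_succ_succ]
    push_cast; rfl
  have ht : (t : ℚ) + 1 ≠ 0 := by positivity
  have hsymm : ((0 + 2 * t + 1).choose (t + 1) : ℚ) = ((0 + 2 * t + 1).choose t : ℚ) := by
    apply mul_right_cancel₀ ht
    simpa using h
  unfold ballot
  rw [hp, hsymm, show 1 + 2 * t = 0 + 2 * t + 1 by ring]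
  have : (t : ℚ) + 2 ≠ 0 := by positivity
  push_cast
  field_simp
  ring

lemma ballot_succ_succ (i t : ℕ) :
    ballot (i + 1) (t + 1) = ballot i (t + 1) + ballot (i + 2) t := by
  have h := choose_succ_mul_succ (i + 1) t
  have hp : ((i + 1 + 2 * (t + 1)).choose (t + 1) : ℚ)
      = ((i + 1 + 2 * t + 1).choose t : ℚ) + ((i + 1 + 2 * t + 1).choose (t + 1) : ℚ) := by
    rw [show i + 1 + 2 * (t + 1) = (i + 1 + 2 * t + 1) + 1 by ring, Nat.choose_succ_succ]
    push_cast; rfl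
  unfold ballot
  rw [hp, show i + 2 * (t + 1) = i + 1 + 2 * t + 1 by ring,
    show i + 2 + 2 * t = i + 1 + 2 * t + 1 by ring]
  generalize ((i + 1 + 2 * t + 1).choose t : ℚ) = A at *
  generalize ((i + 1 + 2 * t + 1).choose (t + 1) : ℚ) = B at *
  have h1 : (i : ℚ) + t + 2 ≠ 0 := by positivity
  have h2 : (i : ℚ) + t + 3 ≠ 0 := by positivity
  push_cast at h ⊢
  rw [show (i : ℚ) + 1 + (t + 1) + 1 = i + t + 3 by ring,
    show (i : ℚ) + (t + 1) + 1 = i + t + 2 by ring,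
    show (i : ℚ) + 2 + t + 1 = i + t + 3 by ring]
  field_simp
  linear_combination h

lemma moBeta_eq_sum (j i N : ℕ) (h : j < i + 2 * N) :
    moBeta j i = ∑ t ∈ range N, ballot i t * (j.choose (i + 2 * t)) := by
  have hext : ∀ M L, j < i + 2 * M → M ≤ L →
      ∑ t ∈ range M, ballot i t * (j.choose (i + 2 * t))
        = ∑ t ∈ range L, ballot i t * (j.choose (i + 2 * t)) := by
    intro M L hM hML
    apply sum_subset (range_mono hML)
    intro t _ ht
    rw [mem_range] at ht
    rw [Nat.choose_eq_zero_of_lt (by omega)]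
    simp
  unfold moBeta
  split_ifs with hij
  · rw [hext N (N + (j + 1)) h (by omega), ← hext (j + 1) (N + (j + 1)) (by omega) (by omega)]
    exact sum_congr rfl fun t _ => by unfold ballot; ring
  · symm
    apply sum_eq_zero
    intro t _
    rw [Nat.choose_eq_zero_of_lt (by omega)]
    simp

lemma moBeta_zero_left (i : ℕ) : moBeta 0 i = if i = 0 then 1 else 0 := by
  rw [moBeta_eq_sum 0 i 1 (by omega)]
  rcases i with _ | i <;> simp [ballot_zero_right]

lemma moBeta_succ_zero (j : ℕ) : moBeta (j + 1) 0 = moBeta j 0 + moBeta j 1 := by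
  rw [moBeta_eq_sum (j + 1) 0 (j + 1 + 1) (by omega), moBeta_eq_sum j 0 (j + 1 + 1) (by omega),
    moBeta_eq_sum j 1 (j + 1) (by omega), sum_range_succ' _ (j + 1), sum_range_succ' _ (j + 1),
    add_right_comm, ← sum_add_distrib]
  congr 1
  · apply sum_congr rfl
    intro t _
    rw [← ballot_zero_succ, show 0 + 2 * (t + 1) = (1 + 2 * t) + 1 by ring, Nat.choose_succ_succ]
    push_cast; ring
  · simp

lemma moBeta_succ_succ (j i : ℕ) :
    moBeta (j + 1) (i + 1) = moBeta j i + moBeta j (i + 1) + moBeta j (i + 2) := by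
  rw [moBeta_eq_sum (j + 1) (i + 1) (j + 1 + 1) (by omega),
    moBeta_eq_sum j i (j + 1 + 1) (by omega), moBeta_eq_sum j (i + 1) (j + 1 + 1) (by omega),
    moBeta_eq_sum j (i + 2) (j + 1) (by omega), ← sum_add_distrib, sum_range_succ' _ (j + 1),
    sum_range_succ' _ (j + 1), add_right_comm (∑ _ ∈ range (j + 1), (_ : ℚ)), ← sum_add_distrib]
  congr 1
  · apply sum_congr rfl
    intro t _
    rw [ballot_succ_succ, show i + 1 + 2 * (t + 1) = (i + 2 + 2 * t) + 1 by ring,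
      show i + 2 * (t + 1) = i + 2 + 2 * t by ring, Nat.choose_succ_succ]
    push_cast; ring
  · simp [ballot_zero_right, Nat.choose_succ_succ]

/-- The coefficient of `x^d` in `(-1)^r·binom(k+r, r)·x^{2r}·(1+x)^{-(k+r+1)}`. -/
noncomputable def muTerm (k d r : ℕ) : ℚ :=
  if 2 * r ≤ d then
    (-1 : ℚ) ^ d * (-1 : ℚ) ^ r * ((k + r).choose r) * ((k + d - r).choose (d - 2 * r))
  else 0

lemma muTerm_add (k r m : ℕ) :
    muTerm k (2 * r + m) r
      = (-1 : ℚ) ^ (m + r) * ((k + r).choose r) * ((k + r + m).choose m) := by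
  rw [muTerm, if_pos (by omega), show k + (2 * r + m) - r = k + r + m by omega,
    Nat.add_sub_cancel_left, ← pow_add, show 2 * r + m + r = 2 * r + (m + r) by ring, pow_add,
    pow_mul]
  simp

lemma muTerm_eq_zero {k d r : ℕ} (h : d < 2 * r) : muTerm k d r = 0 :=
  if_neg (by omega)

lemma moMu_add_eq_sum (k d N : ℕ) (h : d < 2 * N) :
    moMu k (k + d) = ∑ r ∈ range N, muTerm k d r := by
  rw [moMu, if_pos (by omega), Nat.add_sub_cancel_left, mul_sum]
  calc _ = ∑ r ∈ range (d / 2 + 1), muTerm k d r := by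
        apply sum_congr rfl
        intro r hr
        rw [mem_range] at hr
        rw [muTerm, if_pos (by omega)]
        ring
    _ = _ := by
        apply sum_subset (range_mono (by omega))
        intro r _ hr
        rw [mem_range] at hr
        exact muTerm_eq_zero (by omega)

lemma moMu_of_lt {k j : ℕ} (h : j < k) : moMu k j = 0 :=
  if_neg (by omega)

lemma moMu_self (k : ℕ) : moMu k k = 1 := by
  simp [moMu]

lemma moMu_add_one (k : ℕ) : moMu k (k + 1) = -(k + 1) := by
  rw [moMu_add_eq_sum k 1 1 (by omega)]
  simp [muTerm]

lemma muTerm_succ_left_zero (k d : ℕ) :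
    muTerm (k + 1) (d + 1) 0 + muTerm (k + 1) d 0 = muTerm k (d + 1) 0 := by
  have h : ((k + 1 + 0 + (d + 1)).choose (d + 1) : ℚ)
      = ((k + 1 + 0 + d).choose d : ℚ) + ((k + 0 + (d + 1)).choose (d + 1) : ℚ) := by
    rw [show k + 1 + 0 + (d + 1) = (k + 1 + 0 + d) + 1 by ring, Nat.choose_succ_succ,
      show k + 0 + (d + 1) = k + 1 + 0 + d by ring]
    push_cast; rfl
  have e1 := muTerm_add (k + 1) 0 (d + 1)
  have e2 := muTerm_add (k + 1) 0 d
  have e3 := muTerm_add k 0 (d + 1)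
  rw [mul_zero, zero_add] at e1 e2 e3
  rw [e1, e2, e3, h]
  simp only [Nat.choose_zero_right, pow_add, pow_one, pow_zero]
  push_cast; ring

lemma muTerm_succ_left_succ (k d r : ℕ) :
    muTerm (k + 1) (d + 2) (r + 1) + muTerm (k + 1) (d + 1) (r + 1) + muTerm (k + 1) d r
      = muTerm k (d + 2) (r + 1) := by
  rcases lt_or_ge d (2 * r) with h | h
  · rw [muTerm_eq_zero (by omega), muTerm_eq_zero (by omega), muTerm_eq_zero (by omega),
      muTerm_eq_zero (by omega)]
    simp
  obtain ⟨m, rfl⟩ := Nat.exists_eq_add_of_le h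
  have hb : ((k + 1 + (r + 1)).choose (r + 1) : ℚ)
      = ((k + 1 + r).choose r : ℚ) + ((k + (r + 1)).choose (r + 1) : ℚ) := by
    rw [show k + 1 + (r + 1) = (k + 1 + r) + 1 by ring, Nat.choose_succ_succ,
      show k + (r + 1) = k + 1 + r by ring]
    push_cast; rfl
  rw [show 2 * r + m + 2 = 2 * (r + 1) + m by ring, muTerm_add, muTerm_add, muTerm_add, hb]
  rcases m with _ | m
  · rw [muTerm_eq_zero (by omega)]
    simp only [Nat.choose_zero_right, pow_add, pow_one, pow_zero]
    push_cast; ring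
  · rw [show 2 * r + (m + 1) + 1 = 2 * (r + 1) + m by ring, muTerm_add, hb,
      show k + 1 + (r + 1) + (m + 1) = (k + 1 + r + 1 + m) + 1 by ring, Nat.choose_succ_succ,
      show k + 1 + (r + 1) + m = k + 1 + r + 1 + m by ring,
      show k + 1 + r + (m + 1) = k + 1 + r + 1 + m by ring,
      show k + (r + 1) + (m + 1) = k + 1 + r + 1 + m by ring]
    simp only [pow_add, pow_one]
    push_cast; ring

lemma muTerm_zero_left_succ (d r : ℕ) :
    muTerm 0 (d + 2) (r + 1) + muTerm 0 (d + 1) (r + 1) + muTerm 0 d r = 0 := by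
  rcases lt_or_ge d (2 * r) with h | h
  · rw [muTerm_eq_zero (by omega), muTerm_eq_zero (by omega), muTerm_eq_zero (by omega)]
    simp
  obtain ⟨m, rfl⟩ := Nat.exists_eq_add_of_le h
  rw [show 2 * r + m + 2 = 2 * (r + 1) + m by ring, muTerm_add, muTerm_add]
  rcases m with _ | m
  · rw [muTerm_eq_zero (by omega)]
    simp [pow_add]
  · rw [show 2 * r + (m + 1) + 1 = 2 * (r + 1) + m by ring, muTerm_add,
      show 0 + (r + 1) + (m + 1) = (0 + r + 1 + m) + 1 by ring, Nat.choose_succ_succ,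
      show 0 + (r + 1) + m = 0 + r + 1 + m by ring,
      show 0 + r + (m + 1) = 0 + r + 1 + m by ring]
    simp only [pow_add, pow_one, zero_add, Nat.choose_self]
    push_cast; ring

lemma muTerm_zero_left_zero (d : ℕ) : muTerm 0 (d + 1) 0 + muTerm 0 d 0 = 0 := by
  simp [muTerm, pow_succ]

lemma moMu_zero_succ_succ (j : ℕ) : moMu 0 (j + 2) = -moMu 0 (j + 1) - moMu 0 j := by
  have e1 := moMu_add_eq_sum 0 (j + 2) (j + 1 + 1) (by omega)
  have e2 := moMu_add_eq_sum 0 (j + 1) (j + 1 + 1) (by omega)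
  have e3 := moMu_add_eq_sum 0 j (j + 1) (by omega)
  rw [zero_add] at e1 e2 e3
  have hs := sum_congr rfl fun r (_ : r ∈ range (j + 1)) => muTerm_zero_left_succ j r
  rw [sum_add_distrib, sum_add_distrib, sum_const_zero] at hs
  rw [e1, e2, e3, sum_range_succ' _ (j + 1), sum_range_succ' _ (j + 1)]
  linear_combination hs + muTerm_zero_left_zero (j + 1)

lemma moMu_succ_succ_succ (k j : ℕ) :
    moMu (k + 1) (j + 2) = moMu k (j + 1) - moMu (k + 1) (j + 1) - moMu (k + 1) j := by
  rcases lt_or_ge j (k + 1) with h | h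
  · rw [moMu_of_lt h]
    rcases lt_trichotomy k (j + 1) with h' | rfl | h'
    · obtain rfl : j = k := by omega
      rw [show j + 2 = j + 1 + 1 by ring, moMu_add_one, moMu_add_one, moMu_self]
      push_cast; ring
    · rw [moMu_self, moMu_self, moMu_of_lt (by omega)]
      ring
    · rw [moMu_of_lt (by omega), moMu_of_lt (by omega), moMu_of_lt (by omega)]
      ring
  obtain ⟨d, rfl⟩ := Nat.exists_eq_add_of_le h
  have e1 := moMu_add_eq_sum (k + 1) (d + 2) (d + 1 + 1) (by omega)
  have e2 := moMu_add_eq_sum (k + 1) (d + 1) (d + 1 + 1) (by omega)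
  have e3 := moMu_add_eq_sum (k + 1) d (d + 1) (by omega)
  have e4 := moMu_add_eq_sum k (d + 2) (d + 1 + 1) (by omega)
  have hs := sum_congr rfl fun r (_ : r ∈ range (d + 1)) => muTerm_succ_left_succ k d r
  rw [sum_add_distrib, sum_add_distrib] at hs
  rw [show k + 1 + d + 2 = k + 1 + (d + 2) by ring, show k + 1 + d + 1 = k + 1 + (d + 1) by ring,
    e1, e2, e3, show k + 1 + (d + 1) = k + (d + 2) by ring, e4,
    sum_range_succ' _ (d + 1), sum_range_succ' _ (d + 1), sum_range_succ' _ (d + 1)]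
  linear_combination hs + muTerm_succ_left_zero k (d + 1)

lemma sum_range_moBeta_mul_moMu (j : ℕ) : ∀ i N : ℕ, j < N →
    ∑ k ∈ range N, moBeta k i * moMu k j = if i = j then 1 else 0 := by
  have hsub : ∀ (i j N : ℕ),
      ∑ k ∈ range (N + 1), moBeta k i * moMu k (j + 2)
        = ∑ k ∈ range N, moBeta (k + 1) i * moMu k (j + 1)
          - ∑ k ∈ range (N + 1), moBeta k i * moMu k (j + 1)
          - ∑ k ∈ range (N + 1), moBeta k i * moMu k j := by
    intro i j N
    simp only [sum_range_succ' _ N, moMu_succ_succ_succ, moMu_zero_succ_succ, mul_sub,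
      sum_sub_distrib]
    ring
  induction j using Nat.twoStepInduction with
  | zero =>
    intro i N hN
    rw [sum_eq_single_of_mem 0 (mem_range.2 hN)
      fun k _ hk => by rw [moMu_of_lt (by omega), mul_zero]]
    rw [moMu_self, mul_one, moBeta_zero_left]
  | one =>
    intro i N hN
    rw [← sum_subset (range_mono (show 2 ≤ N by omega))
      fun k _ hk => by
        rw [mem_range] at hk
        rw [moMu_of_lt (by omega), mul_zero]]
    rw [sum_range_succ, sum_range_one, moMu_self, show 1 = 0 + 1 by rfl, moMu_add_one]
    rcases i with _ | i
    · rw [moBeta_succ_zero]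
      simp [moBeta_zero_left]
    · rw [moBeta_succ_succ]
      simp [moBeta_zero_left]
  | more j ih0 ih1 =>
    intro i N hN
    obtain ⟨N, rfl⟩ : ∃ M, N = M + 1 := ⟨N - 1, by omega⟩
    rw [hsub, ih0 i (N + 1) (by omega), ih1 i (N + 1) (by omega)]
    rcases i with _ | i
    · simp only [moBeta_succ_zero, add_mul, sum_add_distrib]
      rw [ih1 _ N (by omega), ih1 _ N (by omega)]
      by_cases h : j = 0
      · simp [h]
      · simp [h, Ne.symm h]
    · simp only [moBeta_succ_succ, add_mul, sum_add_distrib]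
      rw [ih1 _ N (by omega), ih1 _ N (by omega), ih1 _ N (by omega)]
      simp only [Nat.add_right_cancel_iff, show i + 2 = j + 1 ↔ i + 1 = j by omega,
        show i + 1 = j + 2 ↔ i = j + 1 by omega]
      ring

/-- The infinite unitriangular matrix `S` with entries `S_{i,k} = β(k,i)` has inverse
given by `μ`: for all natural numbers `i` and `j`, `∑_{k=i}^{j} β(k,i)·μ(k,j)` equals
`1` if `i = j` and `0` otherwise. -/
theorem moBeta_mul_moMu_sum (i j : ℕ) :
    ∑ k ∈ Finset.Icc i j, moBeta k i * moMu k j = if i = j then 1 else 0 := by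
  rw [← sum_range_moBeta_mul_moMu j i (j + 1) (by omega)]
  apply sum_subset
  · intro k hk
    rw [mem_Icc] at hk
    rw [mem_range]
    omega
  · intro k hk hk'
    rw [mem_range] at hk
    rw [mem_Icc] at hk'
    rw [moBeta, if_neg (by omega), zero_mul]
end

section
/- Let β(j,i) = ∑_{t=0}^{j} ((i+1)/(i+t+1))·binom(j, i+2t)·binom(i+2t, t) for i ≤ j and β(j,i) = 0 otherwise. Then for all natural numbers l ≥ 1 and j, one has the identity of rational numbers ∑_{s≥0, 2l+2s≤j} (−1)^s·β(j, 2l+2s) = ∑_{0≤t≤j−2l, t≡j (mod 2)} (4l/(j−t+2l))·binom(j,t)·binom(j−t−1, (j−t)/2 + l − 1). -/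
open Finset

theorem moBeta_even_eq_sum (j l : ℕ) :
    moBeta j (2 * l) = ∑ p ∈ Finset.range (j + 1), (j.choose (2 * p) : ℚ) *
      (if l ≤ p then (2 * (l : ℚ) + 1) / ((p : ℚ) + l + 1) * (2 * p).choose (p - l) else 0) := by
  unfold moBeta
  split_ifs with h
  · refine Finset.sum_bij_ne_zero (fun t _ _ => l + t) ?_ ?_ ?_ ?_
    · intro t ht h0
      rw [Finset.mem_range]
      by_contra hc
      exact h0 (by rw [Nat.choose_eq_zero_of_lt (show j < 2 * l + 2 * t by omega)]; simp)
    · intro a _ _ b _ _ hab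
      simpa using hab
    · intro p hp h0
      have hlp : l ≤ p := by
        by_contra hc
        exact h0 (by simp [hc])
      obtain ⟨t, rfl⟩ := Nat.exists_eq_add_of_le hlp
      refine ⟨t, ?_, ?_, rfl⟩
      · rw [Finset.mem_range] at *
        omega
      · intro hz
        apply h0
        rw [← hz]
        simp only [le_add_iff_nonneg_right, zero_le, if_true, Nat.add_sub_cancel_left, mul_add]
        push_cast
        ring_nf
    · intro t _ _
      simp only [le_add_iff_nonneg_right, zero_le, if_true, Nat.add_sub_cancel_left, mul_add]
      push_cast
      ring_nf
  · symm
    refine Finset.sum_eq_zero fun p _ => ?_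
    split_ifs with hlp
    · rw [Nat.choose_eq_zero_of_lt (show j < 2 * p by omega)]; simp
    · simp

theorem ballot_eq_add (p l : ℕ) (hl : 1 ≤ l) :
    (if l ≤ p then (2 * (l : ℚ) + 1) / ((p : ℚ) + l + 1) * (2 * p).choose (p - l) else 0) =
      (l : ℚ) / p * (2 * p).choose (p + l) +
        ((l + 1 : ℕ) : ℚ) / p * (2 * p).choose (p + (l + 1)) := by
  split_ifs with h
  · have hp : (p : ℚ) ≠ 0 := by
      rw [Nat.cast_ne_zero]
      omega
    have hs : (2 * p).choose (p - l) = (2 * p).choose (p + l) :=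
      Nat.choose_symm_of_eq_add (by omega)
    have hr := Nat.choose_succ_right_eq (2 * p) (p + l)
    rw [show 2 * p - (p + l) = p - l by omega] at hr
    have hq : ((2 * p).choose (p + (l + 1)) : ℚ) * (p + l + 1) =
        (2 * p).choose (p + l) * (p - l) := by
      rw [← Nat.cast_sub h]
      exact_mod_cast hr
    have hd : (p : ℚ) + l + 1 ≠ 0 := by positivity
    rw [hs]
    push_cast
    field_simp
    linear_combination (-(l : ℚ) - 1) * hq
  · rw [Nat.choose_eq_zero_of_lt (show 2 * p < p + l by omega),
      Nat.choose_eq_zero_of_lt (show 2 * p < p + (l + 1) by omega)]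
    simp

theorem moBeta_even_eq_add (j l : ℕ) (hl : 1 ≤ l) :
    moBeta j (2 * l) =
      ∑ p ∈ Finset.range (j + 1),
        (j.choose (2 * p) : ℚ) * ((l : ℚ) / p * (2 * p).choose (p + l)) +
      ∑ p ∈ Finset.range (j + 1),
        (j.choose (2 * p) : ℚ) * (((l + 1 : ℕ) : ℚ) / p * (2 * p).choose (p + (l + 1))) := by
  rw [moBeta_even_eq_sum, ← Finset.sum_add_distrib]
  refine Finset.sum_congr rfl fun p _ => ?_
  rw [ballot_eq_add p l hl, mul_add]

theorem alternating_sum_moBeta (j N l : ℕ) (hl : 1 ≤ l) (hN : j < 2 * (l + N)) :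
    ∑ s ∈ Finset.range N, (-1 : ℚ) ^ s * moBeta j (2 * l + 2 * s) =
      ∑ p ∈ Finset.range (j + 1),
        (j.choose (2 * p) : ℚ) * ((l : ℚ) / p * (2 * p).choose (p + l)) := by
  induction N generalizing l with
  | zero =>
    symm
    refine Finset.sum_eq_zero fun p _ => ?_
    rcases lt_or_ge p l with h | h
    · rw [Nat.choose_eq_zero_of_lt (show 2 * p < p + l by omega)]; simp
    · rw [Nat.choose_eq_zero_of_lt (show j < 2 * p by omega)]; simp
  | succ N ih =>
    have ih' := ih (l + 1) (by omega) (by omega)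
    rw [Finset.sum_range_succ', pow_zero, one_mul, mul_zero, add_zero, moBeta_even_eq_add j l hl,
      ← ih']
    have hneg : ∑ s ∈ Finset.range N, (-1 : ℚ) ^ (s + 1) * moBeta j (2 * l + 2 * (s + 1)) =
        -∑ s ∈ Finset.range N, (-1 : ℚ) ^ s * moBeta j (2 * (l + 1) + 2 * s) := by
      rw [← Finset.sum_neg_distrib]
      refine Finset.sum_congr rfl fun s _ => ?_
      rw [show 2 * l + 2 * (s + 1) = 2 * (l + 1) + 2 * s by ring]
      ring
    rw [hneg]
    ring

theorem choose_pred_mul_div (p l : ℕ) (hl : 1 ≤ l) (hp : 1 ≤ p) :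
    (4 * l : ℚ) / (2 * p + 2 * l) * (2 * p - 1).choose (p + l - 1) =
      (l : ℚ) / p * (2 * p).choose (p + l) := by
  have h := Nat.add_one_mul_choose_eq (2 * p - 1) (p + l - 1)
  rw [show 2 * p - 1 + 1 = 2 * p by omega, show p + l - 1 + 1 = p + l by omega] at h
  have hq : (2 * p : ℚ) * (2 * p - 1).choose (p + l - 1) = (2 * p).choose (p + l) * (p + l) := by
    exact_mod_cast h
  have hp0 : (p : ℚ) ≠ 0 := by
    rw [Nat.cast_ne_zero]
    omega
  have hd : (p : ℚ) + l ≠ 0 := by positivity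
  rw [← mul_add]
  field_simp
  linear_combination 2 * hq

/-- For all natural numbers `l ≥ 1` and `j`, one has
`∑_{s≥0, 2l+2s≤j} (−1)^s·β(j, 2l+2s)
  = ∑_{0≤t≤j−2l, t≡j (mod 2)} (4l/(j−t+2l))·binom(j,t)·binom(j−t−1, (j−t)/2 + l − 1)`,
the character value `χ_{2l}(j)` of the simple module `V_{2l}` of the Motzkin monoid. -/
theorem motzkin_simple_character (l j : ℕ) (hl : 1 ≤ l) :
    ∑ s ∈ (Finset.range (j + 1)).filter (fun s => 2 * l + 2 * s ≤ j),
        (-1 : ℚ) ^ s * moBeta j (2 * l + 2 * s) =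
      ∑ t ∈ (Finset.range (j + 1)).filter (fun t => t + 2 * l ≤ j ∧ t % 2 = j % 2),
        ((4 * l : ℚ) / ((j : ℚ) - (t : ℚ) + 2 * l)) * (j.choose t) *
          ((j - t - 1).choose ((j - t) / 2 + l - 1)) := by
  rw [Finset.sum_filter_of_ne (p := fun s => 2 * l + 2 * s ≤ j),
    alternating_sum_moBeta j (j + 1) l hl (by omega)]
  · symm
    refine Finset.sum_of_injOn (fun t => (j - t) / 2) ?_ ?_ ?_ ?_
    · intro a ha b hb hab
      simp only [Finset.coe_filter, Finset.mem_range, Set.mem_ofPred_eq] at ha hb hab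
      omega
    · intro t ht
      simp only [Finset.coe_filter, Finset.mem_range, Set.mem_ofPred_eq, Finset.coe_range,
        Set.mem_Iio] at ht ⊢
      omega
    · intro p _ hn
      rcases lt_or_ge p l with h | h
      · rw [Nat.choose_eq_zero_of_lt (show 2 * p < p + l by omega)]; simp
      · rw [Nat.choose_eq_zero_of_lt (show j < 2 * p by
          by_contra hc
          refine hn ⟨j - 2 * p, ?_, ?_⟩
          · simp only [Finset.coe_filter, Finset.mem_range, Set.mem_ofPred_eq]
            omega
          · dsimp only
            omega)]
        simp
    · intro t ht
      simp only [Finset.mem_filter, Finset.mem_range] at ht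
      obtain ⟨p, hp⟩ : ∃ p, j = t + 2 * p := ⟨(j - t) / 2, by omega⟩
      subst hp
      have hsymm : (t + 2 * p).choose t = (t + 2 * p).choose (2 * p) :=
        Nat.choose_symm_add
      have hsub : (((t + 2 * p : ℕ) : ℚ) - t + 2 * l) = 2 * p + 2 * l := by
        push_cast
        ring
      rw [hsub, hsymm, Nat.add_sub_cancel_left, Nat.mul_div_cancel_left p two_pos,
        ← choose_pred_mul_div p l hl (by omega)]
      ring
  · intro s _ h0
    by_contra hc
    exact h0 (by rw [moBeta, if_neg hc, mul_zero])
end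

section
/- Let k be a field, M a finite monoid, and V a nonzero finite-dimensional k-vector space with a representation ρ : M → End_k(V) such that ρ(m) = id_V implies m = 1. Let L be the number of distinct principal left ideals M·m for m ∈ M (the number of L-classes of M). Then the tensor power V^{⊗(L−1)}, with M acting diagonally by m ↦ ρ(m)^{⊗(L−1)}, contains a nonzero vector annihilated by every non-invertible element of M; in particular, some tensor power V^{⊗n} with n ≤ L−1 has a composition factor on which all non-units of M act as zero. -/
open scoped TensorProduct

noncomputable section

/-- The diagonal action of a monoid `M` on the `n`-th tensor power of a module `V`,
`m ↦ ρ(m)^{⊗n}`. -/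
def Representation.tensorPower {k M V : Type*} [CommSemiring k] [Monoid M]
    [AddCommMonoid V] [Module k V] (ρ : Representation k M V) (n : ℕ) :
    Representation k M (⨂[k]^n V) where
  toFun m := PiTensorProduct.map fun _ => ρ m
  map_one' := by
    simp only [map_one]
    exact PiTensorProduct.map_one
  map_mul' m m' := by
    simp only [map_mul]
    exact PiTensorProduct.map_mul _ _

/-- The number of `L`-classes of a finite monoid: the number of distinct principal left
ideals `M·m`. -/
def numLeftIdeals (M : Type*) [Monoid M] : ℕ :=
  Nat.card {I : Set M // ∃ m : M, I = {x : M | ∃ y : M, x = y * m}}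

/-- A pure tensor of nonzero vectors over a field is nonzero. -/
theorem PiTensorProduct.tprod_ne_zero_of_forall_ne_zero {k ι V : Type*} [Field k] [Fintype ι]
    [AddCommGroup V] [Module k V] (v : ι → V) (hv : ∀ i, v i ≠ 0) :
    PiTensorProduct.tprod k v ≠ 0 := by
  choose f hf using fun i => Module.Projective.exists_dual_ne_zero k (hv i)
  intro h
  have := congrArg
    (PiTensorProduct.lift ((MultilinearMap.mkPiAlgebra k ι k).compLinearMap f)) h
  rw [PiTensorProduct.lift.tprod, map_zero] at this
  simp [Finset.prod_eq_zero_iff, hf] at this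

/-- In a finite monoid, the principal left ideal of `m` is everything iff `m` is a unit. -/
theorem isUnit_iff_univ_eq_leftIdeal {M : Type*} [Monoid M] [Finite M] {m : M} :
    IsUnit m ↔ Set.univ = {x : M | ∃ y : M, x = y * m} := by
  constructor
  · rintro ⟨u, rfl⟩
    ext x
    simpa using ⟨x * ↑u⁻¹, by simp⟩
  · intro h
    obtain ⟨y, hy⟩ : (1 : M) ∈ {x : M | ∃ y : M, x = y * m} := h ▸ Set.mem_univ _
    exact IsUnit.of_mul_eq_one_right y hy.symm

/-- If only the identity of a finite monoid acts trivially, then every non-unit kills some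
nonzero vector. -/
theorem Representation.exists_ne_zero_apply_eq_zero_of_not_isUnit {k M V : Type*} [Field k]
    [Monoid M] [Finite M] [AddCommGroup V] [Module k V] [FiniteDimensional k V]
    (ρ : Representation k M V) (hρ : ∀ m : M, ρ m = 1 → m = 1) {m : M} (hm : ¬IsUnit m) :
    ∃ v : V, v ≠ 0 ∧ ρ m v = 0 := by
  by_contra! h
  have hinj : Function.Injective (ρ m) :=
    (injective_iff_map_eq_zero _).2 fun v hv => by_contra fun h0 => h v h0 hv
  have hu : IsUnit (ρ m) := (Module.End.isUnit_iff _).2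
    ⟨hinj, LinearMap.injective_iff_surjective.1 hinj⟩
  obtain ⟨i, j, hij, he⟩ : ∃ i j : ℕ, i < j ∧ m ^ i = m ^ j := by
    obtain ⟨i, j, hne, he⟩ := Finite.exists_ne_map_eq_of_infinite (fun n : ℕ => m ^ n)
    rcases hne.lt_or_gt with hlt | hlt
    exacts [⟨i, j, hlt, he⟩, ⟨j, i, hlt, he.symm⟩]
  have h1 : m ^ (j - i) = 1 := hρ _ <| (hu.pow i).mul_left_cancel <| by
    rw [← map_pow, ← map_mul, ← pow_add, Nat.add_sub_cancel' hij.le, ← he, mul_one]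
  exact hm (IsUnit.of_pow_eq_one h1 (Nat.sub_pos_of_lt hij).ne')

/-- The number of principal left ideals other than the whole finite monoid. -/
theorem card_proper_leftIdeals (M : Type*) [Monoid M] [Finite M] :
    Nat.card {I : {I : Set M // ∃ m : M, I = {x : M | ∃ y : M, x = y * m}} //
      I.1 ≠ Set.univ} = numLeftIdeals M - 1 := by
  classical
  let U : {I : Set M // ∃ m : M, I = {x : M | ∃ y : M, x = y * m}} :=
    ⟨Set.univ, 1, isUnit_iff_univ_eq_leftIdeal.1 isUnit_one⟩
  have hcard := Set.ncard_compl ({U} : Set _)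
  rw [Set.ncard_singleton] at hcard
  rw [numLeftIdeals, ← hcard, ← Nat.card_coe_set_eq]
  refine Nat.card_congr (Equiv.subtypeEquivRight fun I => ?_)
  simp [U, Subtype.ext_iff]

/-- Let `k` be a field, `M` a finite monoid, and `V` a nonzero finite-dimensional
`k`-vector space with a representation `ρ : M → End_k(V)` such that `ρ(m) = id_V` implies
`m = 1`. Let `L` be the number of `L`-classes of `M`. Then the tensor power `V^{⊗(L−1)}`,
with `M` acting diagonally, contains a nonzero vector annihilated by every non-invertible
element of `M`. -/
theorem exists_nonzero_annihilated_vector_of_tensorPower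
    {k M V : Type*} [Field k] [Monoid M] [Fintype M]
    [AddCommGroup V] [Module k V] [FiniteDimensional k V] [Nontrivial V]
    (ρ : Representation k M V) (hρ : ∀ m : M, ρ m = 1 → m = 1) :
    ∃ v : ⨂[k]^(numLeftIdeals M - 1) V, v ≠ 0 ∧
      ∀ m : M, ¬IsUnit m → (ρ.tensorPower (numLeftIdeals M - 1)) m v = 0 := by
  classical
  let e := (Finite.equivFin {I : {I : Set M // ∃ m : M, I = {x : M | ∃ y : M, x = y * m}} //
    I.1 ≠ Set.univ}).trans (finCongr (card_proper_leftIdeals M))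
  have hker (i : Fin (numLeftIdeals M - 1)) : ∃ v : V, v ≠ 0 ∧
      ∀ m : M, (e.symm i).1.1 = {x : M | ∃ y : M, x = y * m} → ρ m v = 0 := by
    obtain ⟨⟨⟨I, a, rfl⟩, ha⟩, rfl⟩ := e.surjective i
    obtain ⟨v, hv, hav⟩ := ρ.exists_ne_zero_apply_eq_zero_of_not_isUnit hρ (m := a)
      fun hu => ha (isUnit_iff_univ_eq_leftIdeal.1 hu).symm
    refine ⟨v, hv, fun m hm => ?_⟩
    rw [Equiv.symm_apply_apply] at hm
    obtain ⟨y, rfl⟩ : m ∈ {x : M | ∃ y : M, x = y * a} :=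
      hm.ge ⟨1, (one_mul m).symm⟩
    simp [hav]
  choose v hv hkill using hker
  refine ⟨PiTensorProduct.tprod k v,
    PiTensorProduct.tprod_ne_zero_of_forall_ne_zero v hv, fun m hm => ?_⟩
  let i := e ⟨⟨_, m, rfl⟩, fun h => hm (isUnit_iff_univ_eq_leftIdeal.2 h.symm)⟩
  change PiTensorProduct.map (fun _ => ρ m) (PiTensorProduct.tprod k v) = 0
  rw [PiTensorProduct.map_tprod]
  exact MultilinearMap.map_coord_zero _ i (hkill i m (by simp [i]))

end
end

section
/- Let k be an algebraically closed field, M a finite monoid with group of units G = Mˣ, and V a nonzero finite-dimensional kM-module, given by ρ : M → End_k(V), such that ρ(m) = id_V implies m = 1. For n ∈ ℕ let l_M(n) be the composition-series length of V^{⊗n} as a module over the monoid algebra k[M], and let l_G(n) be the composition-series length of V^{⊗n} as a module over the group algebra k[G] via restriction of the action. Then l_M(n)/l_G(n) → 1 as n → ∞. -/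
open scoped TensorProduct

noncomputable section

section Length

variable {k A B W : Type*} [Field k] [Ring A] [Algebra k A] [Ring B] [Algebra k B]
  [AddCommGroup W] [Module k W] [Module A W] [IsScalarTower k A W]

/-- The rank of an endomorphism is at least the sum of the ranks it induces on an invariant
subspace and on the quotient by it. -/
theorem LinearMap.finrank_range_add_finrank_range_le {W₁ W₂ : Type*} [AddCommGroup W₁] [Module k W₁]
    [AddCommGroup W₂] [Module k W₂] [Module.Finite k W]
    (i : W₁ →ₗ[k] W) (p : W →ₗ[k] W₂) (hi : Function.Injective i) (hp : Function.Surjective p)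
    (hpi : ∀ x, p (i x) = 0) (f : W →ₗ[k] W) (f₁ : W₁ →ₗ[k] W₁) (f₂ : W₂ →ₗ[k] W₂)
    (h₁ : ∀ x, f (i x) = i (f₁ x)) (h₂ : ∀ x, p (f x) = f₂ (p x)) :
    Module.finrank k (LinearMap.range f₁) + Module.finrank k (LinearMap.range f₂) ≤
      Module.finrank k (LinearMap.range f) := by
  let q := p.domRestrict (LinearMap.range f)
  have hq : LinearMap.range q = LinearMap.range f₂ := by
    ext y
    constructor
    · rintro ⟨⟨_, x, rfl⟩, rfl⟩
      exact ⟨p x, (h₂ x).symm⟩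
    · rintro ⟨y, rfl⟩
      obtain ⟨x, rfl⟩ := hp y
      exact ⟨⟨f x, x, rfl⟩, h₂ x⟩
  have hker : Module.finrank k (LinearMap.range f₁) ≤ Module.finrank k (LinearMap.ker q) := by
    let j : LinearMap.range f₁ →ₗ[k] LinearMap.ker q :=
      ((i.domRestrict (LinearMap.range f₁)).codRestrict (LinearMap.range f) (by
        rintro ⟨_, x, rfl⟩
        exact ⟨i x, h₁ x⟩)).codRestrict (LinearMap.ker q) fun x => hpi x
    refine LinearMap.finrank_le_finrank_of_injective (f := j) fun x y hxy => ?_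
    exact Subtype.ext (hi (congrArg (fun z => (z.1 : W)) hxy))
  rw [← LinearMap.finrank_range_add_finrank_ker q, hq, add_comm]
  exact Nat.add_le_add_left hker _

theorem Module.finite_submodule_of_isScalarTower [Module.Finite k W] (N : Submodule A W) :
    Module.Finite k N :=
  inferInstanceAs (Module.Finite k (N.restrictScalars k))

theorem Module.finite_quotient_of_isScalarTower [Module.Finite k W] (N : Submodule A W) :
    Module.Finite k (W ⧸ N) :=
  Module.Finite.of_surjective (N.mkQ.restrictScalars k) N.mkQ_surjective

theorem Algebra.finrank_range_lsmul_submodule_add_quotient_le [Module.Finite k W]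
    (N : Submodule A W) (a : A) :
    Module.finrank k (LinearMap.range (Algebra.lsmul k k N a)) +
      Module.finrank k (LinearMap.range (Algebra.lsmul k k (W ⧸ N) a)) ≤
      Module.finrank k (LinearMap.range (Algebra.lsmul k k W a)) :=
  LinearMap.finrank_range_add_finrank_range_le (N.subtype.restrictScalars k)
    (N.mkQ.restrictScalars k) N.subtype_injective N.mkQ_surjective (by simp) _ _ _
    (fun _ => rfl) (fun _ => rfl)

theorem Module.length_le_finrank_of_isScalarTower [Module.Finite k W] :
    Module.length A W ≤ Module.finrank k W := by
  rw [← Module.length_eq_finrank k W, ← Module.length_top (R := A), ← Module.length_top (R := k)]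
  exact Submodule.length_le_length_restrictScalars k (⊤ : Submodule A W)

theorem IsSimpleModule.finrank_le_finrank [Module.Finite k A] [IsSimpleModule A W] :
    Module.finrank k W ≤ Module.finrank k A := by
  have := IsSimpleModule.nontrivial A W
  obtain ⟨w, hw⟩ := exists_ne (0 : W)
  exact LinearMap.finrank_le_finrank_of_surjective
    (f := (LinearMap.toSpanSingleton A W w).restrictScalars k)
    (IsSimpleModule.toSpanSingleton_surjective A hw)

variable [Module B A] [Module B W] [IsScalarTower B A W]
  [IsScalarTower k B W]

theorem IsSimpleModule.length_le_one_add_mul_sum_finrank_range [Module.Finite k A]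
    [Module.Finite k W] [IsSimpleModule A W]
    (S : Finset A) (hS : ∀ a : A, ∃ b : B, a - b • (1 : A) ∈ Submodule.span k (S : Set A)) :
    Module.length B W ≤ 1 + Module.finrank k A *
      ∑ a ∈ S, (Module.finrank k (LinearMap.range (Algebra.lsmul k k W a)) : ℕ∞) := by
  by_cases h : ∀ a ∈ S, ∀ w : W, a • w = 0
  · have hspan : ∀ a ∈ Submodule.span k (S : Set A), ∀ w : W, a • w = 0 := by
      intro a ha w
      induction ha using Submodule.span_induction with
      | mem a ha => exact h a ha w
      | zero => simp
      | add a b _ _ ha hb => rw [add_smul, ha, hb, add_zero]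
      | smul c a _ ha => rw [smul_assoc, ha, smul_zero]
    have hsmul : ∀ a : A, ∃ b : B, ∀ w : W, a • w = b • w := by
      intro a
      obtain ⟨b, hb⟩ := hS a
      refine ⟨b, fun w => ?_⟩
      have := hspan _ hb w
      rwa [sub_smul, smul_assoc, one_smul, sub_eq_zero] at this
    have : IsSimpleModule B W := by
      have := IsSimpleModule.nontrivial A W
      rw [isSimpleModule_iff_toSpanSingleton_surjective]
      refine ⟨inferInstance, fun w hw y => ?_⟩
      obtain ⟨a, rfl⟩ := IsSimpleModule.toSpanSingleton_surjective A hw y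
      obtain ⟨b, hb⟩ := hsmul a
      exact ⟨b, (hb w).symm⟩
    rw [Module.length_eq_one]
    exact le_self_add
  · push Not at h
    obtain ⟨a, ha, w, hw⟩ := h
    have hpos : 0 < Module.finrank k (LinearMap.range (Algebra.lsmul k k W a)) := by
      have : Nontrivial (LinearMap.range (Algebra.lsmul k k W a)) :=
        ⟨⟨a • w, w, rfl⟩, 0, fun h => hw (congrArg Subtype.val h)⟩
      exact Module.finrank_pos
    have hone : (1 : ℕ∞) ≤
        ∑ a ∈ S, (Module.finrank k (LinearMap.range (Algebra.lsmul k k W a)) : ℕ∞) :=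
      le_trans (by exact_mod_cast hpos)
        (Finset.single_le_sum (f := fun a =>
          (Module.finrank k (LinearMap.range (Algebra.lsmul k k W a)) : ℕ∞))
          (fun _ _ => zero_le) ha)
    calc Module.length B W ≤ Module.finrank k W := Module.length_le_finrank_of_isScalarTower
      _ ≤ Module.finrank k A := by exact_mod_cast IsSimpleModule.finrank_le_finrank (A := A)
      _ = Module.finrank k A * 1 := (mul_one _).symm
      _ ≤ Module.finrank k A * _ := mul_le_mul_right hone _
      _ ≤ _ := le_add_self

end Length

theorem IsFiniteLength.finrank_le_mul_length {k A W : Type*} [Field k] [Ring A] [Algebra k A]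
    [Module.Finite k A] [AddCommGroup W] [Module A W] (h : IsFiniteLength A W) :
    ∀ [Module k W] [IsScalarTower k A W] [Module.Finite k W],
      (Module.finrank k W : ℕ∞) ≤ Module.finrank k A * Module.length A W := by
  induction h with
  | of_subsingleton =>
    intros
    simp [Module.finrank_zero_of_subsingleton]
  | @of_simple_quotient W _ _ N _ _ ih =>
    intro _ _ _
    have := Module.finite_submodule_of_isScalarTower (k := k) N
    have hN := @ih _ _ _
    have hQ : Module.finrank k (W ⧸ N) ≤ Module.finrank k A := IsSimpleModule.finrank_le_finrank
    have hk : Module.finrank k (W ⧸ N) + Module.finrank k N = Module.finrank k W :=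
      (N.restrictScalars k).finrank_quotient_add_finrank
    rw [Module.length_eq_add_of_exact N.subtype N.mkQ N.subtype_injective N.mkQ_surjective
      (LinearMap.exact_subtype_mkQ N), Module.length_eq_one A (W ⧸ N), mul_add, mul_one, ← hk, Nat.cast_add,
      add_comm]
    exact add_le_add hN (mod_cast hQ)

theorem IsFiniteLength.length_le_length_add_mul_sum_finrank_range
    {k A B W : Type*} [Field k] [Ring A] [Algebra k A] [Ring B] [Algebra k B] [Module.Finite k A]
    [Module B A] [IsScalarTower k B A] [IsScalarTower B A A]
    (S : Finset A) (hS : ∀ a : A, ∃ b : B, a - b • (1 : A) ∈ Submodule.span k (S : Set A))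
    [AddCommGroup W] [Module A W] (h : IsFiniteLength A W) :
    ∀ [Module k W] [IsScalarTower k A W] [Module B W] [IsScalarTower B A W]
      [IsScalarTower k B W] [Module.Finite k W],
      Module.length B W ≤ Module.length A W + Module.finrank k A *
        ∑ a ∈ S, (Module.finrank k (LinearMap.range (Algebra.lsmul k k W a)) : ℕ∞) := by
  induction h with
  | of_subsingleton =>
    intros
    simp
  | @of_simple_quotient W _ _ N _ _ ih =>
    intro _ _ _ _ _ _
    have := Module.finite_submodule_of_isScalarTower (k := k) N
    have := Module.finite_quotient_of_isScalarTower (k := k) N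
    have : IsScalarTower k B N := ⟨fun x y z => Subtype.ext (smul_assoc x y (z : W))⟩
    have : IsScalarTower k B (W ⧸ N) := ⟨fun x y z => by
      induction z using Submodule.Quotient.induction_on with
      | H z => exact congrArg N.mkQ (smul_assoc x y z)⟩
    have hQ := IsSimpleModule.length_le_one_add_mul_sum_finrank_range (W := W ⧸ N) S hS
    rw [Module.length_eq_add_of_exact N.subtype N.mkQ N.subtype_injective N.mkQ_surjective
      (LinearMap.exact_subtype_mkQ N), Module.length_eq_one A (W ⧸ N),
      Module.length_eq_add_of_exact (R := B) (N.subtype.restrictScalars B)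
        (N.mkQ.restrictScalars B) N.subtype_injective N.mkQ_surjective
      (LinearMap.exact_subtype_mkQ N)]
    calc _ ≤ _ := add_le_add ih hQ
      _ = Module.length A N + 1 + Module.finrank k A * ∑ a ∈ S,
          ((Module.finrank k (LinearMap.range (Algebra.lsmul k k N a)) +
            Module.finrank k (LinearMap.range (Algebra.lsmul k k (W ⧸ N) a)) : ℕ) : ℕ∞) := by
        simp only [Nat.cast_add, Finset.sum_add_distrib]
        ring
      _ ≤ _ := by
        gcongr with a ha
        exact Algebra.finrank_range_lsmul_submodule_add_quotient_le N a

theorem Module.finrank_tensorPower (k V : Type*) [Field k] [AddCommGroup V] [Module k V]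
    [Module.Finite k V] (n : ℕ) : Module.finrank k (⨂[k]^n V) = Module.finrank k V ^ n := by
  rw [Module.finrank_eq_card_basis
    (Basis.piTensorProduct fun _ : Fin n => Module.finBasis k V)]
  simp

theorem PiTensorProduct.finrank_range_map_le {k V : Type*} [Field k] [AddCommGroup V] [Module k V]
    [Module.Finite k V] (f : V →ₗ[k] V) (n : ℕ) :
    Module.finrank k (LinearMap.range (PiTensorProduct.map fun _ : Fin n => f)) ≤
      Module.finrank k (LinearMap.range f) ^ n := by
  have h : (PiTensorProduct.map fun _ : Fin n => f) =
      (PiTensorProduct.map fun _ : Fin n => (LinearMap.range f).subtype) ∘ₗ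
        PiTensorProduct.map fun _ : Fin n => f.rangeRestrict := by
    rw [← PiTensorProduct.map_comp]
    rfl
  rw [← Module.finrank_tensorPower, h]
  exact (Submodule.finrank_mono (LinearMap.range_comp_le_range _ _)).trans
    (LinearMap.finrank_range_le _)

section Representation

open MonoidAlgebra

variable {k M U : Type*} [Field k] [Monoid M] [AddCommGroup U] [Module k U]

theorem MonoidAlgebra.finrank_eq_natCard (k M : Type*) [Field k] [Monoid M] [Finite M] :
    Module.finrank k (MonoidAlgebra k M) = Nat.card M := by
  have := Fintype.ofFinite M
  rw [(MonoidAlgebra.coeffLinearEquiv k).finrank_eq]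
  simp

theorem MonoidAlgebra.finite_of_finite (k M : Type*) [Field k] [Monoid M] [Finite M] :
    Module.Finite k (MonoidAlgebra k M) :=
  Module.Finite.equiv (MonoidAlgebra.coeffLinearEquiv k).symm

/-- Every element of `k[M]` is, up to a combination of non-units of `M`, in the image of `k[Mˣ]`. -/
theorem MonoidAlgebra.exists_sub_mapDomain_mem_span {S : Set M} (hS : ∀ m, ¬ IsUnit m → m ∈ S)
    (a : MonoidAlgebra k M) :
    ∃ b : MonoidAlgebra k Mˣ, a - mapDomainAlgHom k k (Units.coeHom M) b ∈
      Submodule.span k (of k M '' S) := by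
  induction a using MonoidAlgebra.induction_on with
  | of m =>
    by_cases hm : IsUnit m
    · obtain ⟨u, rfl⟩ := hm
      exact ⟨of k Mˣ u, by simp⟩
    · exact ⟨0, by simpa using Submodule.subset_span (R := k) (Set.mem_image_of_mem (of k M) (hS m hm))⟩
  | add x y hx hy =>
    obtain ⟨b, hb⟩ := hx
    obtain ⟨c, hc⟩ := hy
    exact ⟨b + c, by simpa only [map_add, add_sub_add_comm] using add_mem hb hc⟩
  | smul r x hx =>
    obtain ⟨b, hb⟩ := hx
    exact ⟨r • b, by simpa only [map_smul, smul_sub] using Submodule.smul_mem _ r hb⟩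

theorem Representation.mapDomainAlgHom_units_smul (σ : Representation k M U)
    (b : MonoidAlgebra k Mˣ) (u : U) :
    mapDomainAlgHom k k (Units.coeHom M) b • σ.asModuleEquiv.symm u =
      σ.asModuleEquiv.symm (asAlgebraHom (σ.comp (Units.coeHom M)) b u) := by
  rw [LinearEquiv.eq_symm_apply, asModuleEquiv_map_smul, LinearEquiv.apply_symm_apply]
  have h : σ.asAlgebraHom.comp (mapDomainAlgHom k k (Units.coeHom M)) =
      asAlgebraHom (σ.comp (Units.coeHom M)) := by
    ext
    simp
  rw [← h]
  rfl

theorem Representation.length_le_length_units_and_length_units_le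
    [Finite M] [Module.Finite k U] (σ : Representation k M U)
    (S : Finset M) (hS : ∀ m, ¬ IsUnit m → m ∈ S) :
    Module.length (MonoidAlgebra k M) σ.asModule ≤
      Module.length (MonoidAlgebra k Mˣ)
        (Representation.asModule (σ.comp (Units.coeHom M))) ∧
    Module.length (MonoidAlgebra k Mˣ)
        (Representation.asModule (σ.comp (Units.coeHom M))) ≤
      Module.length (MonoidAlgebra k M) σ.asModule +
        Nat.card M * ∑ m ∈ S, (Module.finrank k (LinearMap.range (σ m)) : ℕ∞) := by
  classical
  have hfin := MonoidAlgebra.finite_of_finite k M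
  let φ : MonoidAlgebra k Mˣ →ₐ[k] MonoidAlgebra k M := mapDomainAlgHom k k (Units.coeHom M)
  let : Module (MonoidAlgebra k Mˣ) (MonoidAlgebra k M) := Module.compHom _ φ.toRingHom
  let : Module (MonoidAlgebra k Mˣ) σ.asModule :=
    inferInstanceAs (Module (MonoidAlgebra k Mˣ)
      (Representation.asModule (σ.comp (Units.coeHom M))))
  have : IsScalarTower k (MonoidAlgebra k Mˣ) σ.asModule :=
    inferInstanceAs (IsScalarTower k (MonoidAlgebra k Mˣ)
      (Representation.asModule (σ.comp (Units.coeHom M))))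
  have : IsScalarTower (MonoidAlgebra k Mˣ) (MonoidAlgebra k M) σ.asModule := ⟨fun b a w => by
    change (φ b * a) • w = _
    rw [mul_smul]
    exact σ.mapDomainAlgHom_units_smul b (a • w)⟩
  have hfl : IsFiniteLength (MonoidAlgebra k M) σ.asModule := by
    rw [← Module.length_ne_top_iff]
    exact ne_top_of_le_ne_top (ENat.natCast_ne_top _) (Module.length_le_finrank_of_isScalarTower (k := k))
  have : IsScalarTower (MonoidAlgebra k Mˣ) (MonoidAlgebra k M) (MonoidAlgebra k M) :=
    ⟨fun b x y => mul_assoc (φ b) x y⟩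
  have : IsScalarTower k (MonoidAlgebra k Mˣ) (MonoidAlgebra k M) := ⟨fun c b x => by
    change φ (c • b) * x = c • (φ b * x)
    rw [map_smul, smul_mul_assoc]⟩
  constructor
  · have := Submodule.length_le_length_restrictScalars (MonoidAlgebra k Mˣ)
      (⊤ : Submodule (MonoidAlgebra k M) σ.asModule)
    rwa [Submodule.restrictScalars_top, Module.length_top, Module.length_top] at this
  · have := hfl.length_le_length_add_mul_sum_finrank_range (k := k) (B := MonoidAlgebra k Mˣ)
      (S.image (of k M)) fun a => by
        obtain ⟨b, hb⟩ := MonoidAlgebra.exists_sub_mapDomain_mem_span (k := k) (S := S) hS a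
        refine ⟨b, ?_⟩
        change a - φ b * 1 ∈ _
        rwa [mul_one, Finset.coe_image]
    rw [MonoidAlgebra.finrank_eq_natCard, Finset.sum_image (of_injective.injOn)] at this
    refine this.trans_eq ?_
    refine congrArg (_ + _ * ·) (Finset.sum_congr rfl fun m _ => ?_)
    have h : (Algebra.lsmul k k σ.asModule (of k M m) : U →ₗ[k] U) = σ m := by
      ext u
      exact (single_smul σ 1 m (σ.asModuleEquiv.symm u)).trans (one_smul _ _)
    exact congrArg (fun f : U →ₗ[k] U => (Module.finrank k (LinearMap.range f) : ℕ∞)) h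

theorem Representation.finrank_le_natCard_mul_length
    [Finite M] [Module.Finite k U] (σ : Representation k M U) :
    (Module.finrank k U : ℕ∞) ≤ Nat.card M * Module.length (MonoidAlgebra k M) σ.asModule := by
  have hfin := MonoidAlgebra.finite_of_finite k M
  rw [← MonoidAlgebra.finrank_eq_natCard k M, ← σ.asModuleEquiv.finrank_eq]
  refine IsFiniteLength.finrank_le_mul_length ?_
  rw [← Module.length_ne_top_iff]
  exact ne_top_of_le_ne_top (ENat.natCast_ne_top _) (Module.length_le_finrank_of_isScalarTower (k := k))

theorem Representation.isUnit_of_isUnit_apply [Finite M] (ρ : Representation k M U)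
    (hρ : ∀ m : M, ρ m = 1 → m = 1) {m : M} (hm : IsUnit (ρ m)) : IsUnit m := by
  obtain ⟨i, j, hij, h⟩ := Finite.exists_ne_map_eq_of_infinite fun n : ℕ => m ^ n
  wlog hlt : i < j generalizing i j
  · exact this j i hij.symm h.symm (by omega)
  have hpow : ρ (m ^ (j - i)) = 1 := by
    apply (hm.pow i).mul_left_cancel
    rw [← map_pow, ← map_mul, ← pow_add, Nat.add_sub_cancel' hlt.le, mul_one]
    exact congrArg ρ h.symm
  exact IsUnit.of_pow_eq_one (hρ _ hpow) (by omega)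

theorem Representation.finrank_range_lt [Finite M] [Module.Finite k U] (ρ : Representation k M U)
    (hρ : ∀ m : M, ρ m = 1 → m = 1) {m : M} (hm : ¬ IsUnit m) :
    Module.finrank k (LinearMap.range (ρ m)) < Module.finrank k U := by
  refine Submodule.finrank_lt fun h => hm (ρ.isUnit_of_isUnit_apply hρ ?_)
  rwa [LinearMap.isUnit_iff_range_eq_top]

end Representation

/-- Let `k` be an algebraically closed field, `M` a finite monoid with group of units
`G = Mˣ`, and `V` a nonzero finite-dimensional `kM`-module such that `ρ(m) = id_V`
implies `m = 1`. If `l_M(n)` is the composition-series length of `V^{⊗n}` over the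
monoid algebra `k[M]` and `l_G(n)` is the composition-series length of `V^{⊗n}` over the
group algebra `k[G]` (via restriction), then `l_M(n)/l_G(n) → 1` as `n → ∞`. -/
theorem tendsto_length_ratio_monoid_div_units
    {k M V : Type*} [Field k] [IsAlgClosed k] [Monoid M] [Fintype M]
    [AddCommGroup V] [Module k V] [FiniteDimensional k V] [Nontrivial V]
    (ρ : Representation k M V) (hρ : ∀ m : M, ρ m = 1 → m = 1)
    (lM lG : ℕ → ℕ)
    (hlM : ∀ n : ℕ, ∃ s : CompositionSeries
        (Submodule (MonoidAlgebra k M) ((ρ.tensorPower n).asModule)),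
        s.head = ⊥ ∧ s.last = ⊤ ∧ s.length = lM n)
    (hlG : ∀ n : ℕ, ∃ s : CompositionSeries
        (Submodule (MonoidAlgebra k Mˣ) (Representation.asModule ((ρ.tensorPower n).comp (Units.coeHom M)))),
        s.head = ⊥ ∧ s.last = ⊤ ∧ s.length = lG n) :
    Filter.Tendsto (fun n : ℕ => (lM n : ℝ) / (lG n : ℝ)) Filter.atTop (nhds 1) := by
  classical
  let S : Finset M := Finset.univ.filter fun m => ¬ IsUnit m
  have hM (n : ℕ) : Module.length (MonoidAlgebra k M) (ρ.tensorPower n).asModule = lM n := by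
    obtain ⟨s, h₁, h₂, h₃⟩ := hlM n
    rw [← Module.length_compositionSeries s h₁ h₂, h₃]
  have hG (n : ℕ) : Module.length (MonoidAlgebra k Mˣ)
      (Representation.asModule ((ρ.tensorPower n).comp (Units.coeHom M))) = lG n := by
    obtain ⟨s, h₁, h₂, h₃⟩ := hlG n
    rw [← Module.length_compositionSeries s h₁ h₂, h₃]
  set d := Module.finrank k V with hd
  have hd0 : 0 < d := Module.finrank_pos
  have hbound (n : ℕ) := (ρ.tensorPower n).length_le_length_units_and_length_units_le S
    (by simp [S])
  simp only [hM, hG] at hbound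
  have hle (n : ℕ) : lM n ≤ lG n := by exact_mod_cast (hbound n).1
  set C := Nat.card M * S.card with hC
  have hge (n : ℕ) : lG n ≤ lM n + C * (d - 1) ^ n := by
    have h₁ : lG n ≤ lM n + Nat.card M *
        ∑ m ∈ S, Module.finrank k (LinearMap.range (ρ.tensorPower n m)) := by
      exact_mod_cast (hbound n).2
    have h₂ : ∑ m ∈ S, Module.finrank k (LinearMap.range (ρ.tensorPower n m)) ≤
        S.card • (d - 1) ^ n := by
      refine Finset.sum_le_card_nsmul _ _ _ fun m hm => ?_
      refine (PiTensorProduct.finrank_range_map_le (ρ m) n).trans (Nat.pow_le_pow_left ?_ n)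
      exact Nat.le_sub_one_of_lt (ρ.finrank_range_lt hρ (by simpa [S] using hm))
    rw [smul_eq_mul] at h₂
    rw [hC, mul_assoc]
    exact h₁.trans (Nat.add_le_add_left (Nat.mul_le_mul_left _ h₂) _)
  have hdim (n : ℕ) : d ^ n ≤ Nat.card Mˣ * lG n := by
    have := Representation.finrank_le_natCard_mul_length
      ((ρ.tensorPower n).comp (Units.coeHom M))
    rw [hG, Module.finrank_tensorPower] at this
    exact_mod_cast this
  have hpos (n : ℕ) : (0 : ℝ) < lG n := by
    have := (Nat.pow_pos hd0).trans_le (hdim n)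
    exact_mod_cast Nat.pos_of_mul_pos_left this
  have hlim : Filter.Tendsto (fun n : ℕ => 1 - (C * Nat.card Mˣ : ℝ) * (((d - 1 : ℕ) : ℝ) / d) ^ n)
      Filter.atTop (nhds 1) := by
    have h := tendsto_pow_atTop_nhds_zero_of_lt_one (r := ((d - 1 : ℕ) : ℝ) / d) (by positivity)
      ((div_lt_one (by exact_mod_cast hd0)).2 (by exact_mod_cast Nat.sub_lt hd0 one_pos))
    simpa using (h.const_mul (C * Nat.card Mˣ : ℝ)).const_sub 1
  refine tendsto_of_tendsto_of_tendsto_of_le_of_le hlim tendsto_const_nhds (fun n => ?_)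
    fun n => (div_le_one (hpos n)).2 (by exact_mod_cast hle n)
  have hdn : (0 : ℝ) < (d : ℝ) ^ n := by positivity
  have hge' : (lG n : ℝ) ≤ lM n + C * ((d - 1 : ℕ) : ℝ) ^ n := by exact_mod_cast hge n
  have hdim' : (d : ℝ) ^ n ≤ Nat.card Mˣ * lG n := by exact_mod_cast hdim n
  have hCn : (0 : ℝ) ≤ C * ((d - 1 : ℕ) : ℝ) ^ n := by positivity
  change _ ≤ (lM n : ℝ) / lG n
  rw [le_div_iff₀ (hpos n), div_pow, sub_mul, one_mul]
  have : C * ((d - 1 : ℕ) : ℝ) ^ n ≤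
      C * Nat.card Mˣ * (((d - 1 : ℕ) : ℝ) ^ n / (d : ℝ) ^ n) * lG n := by
    rw [mul_div_assoc', div_mul_eq_mul_div, le_div_iff₀ hdn]
    nlinarith [mul_le_mul_of_nonneg_left hdim' hCn]
  linarith

end
end

section
/- Let k be an algebraically closed field and M a finite monoid whose group of units is trivial (every unit of M equals 1). Let V be a nonzero finite-dimensional kM-module, given by ρ : M → End_k(V), such that ρ(m) = id_V implies m = 1, and let l(n) be the composition-series length of V^{⊗n} as a module over the monoid algebra k[M]. Then l(n)/(dim_k V)^n → 1 as n → ∞. -/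
open scoped TensorProduct

noncomputable section

theorem Submodule.finrank_finset_sup_le {k W ι : Type*} [Field k] [AddCommGroup W] [Module k W]
    [FiniteDimensional k W] (s : Finset ι) (p : ι → Submodule k W) :
    Module.finrank k (s.sup p : Submodule k W) ≤ ∑ i ∈ s, Module.finrank k (p i) := by
  classical
  induction s using Finset.induction_on with
  | empty => simp
  | insert i s hi ih =>
    rw [Finset.sup_insert, Finset.sum_insert hi]
    exact (Submodule.finrank_add_le_finrank_add_finrank _ _).trans (Nat.add_le_add_left ih _)

namespace PiTensorProduct

theorem finrank_tensorPower {k V : Type*} [Field k] [AddCommGroup V] [Module k V]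
    [FiniteDimensional k V] (n : ℕ) :
    Module.finrank k (⨂[k]^n V) = Module.finrank k V ^ n := by
  rw [Module.finrank_eq_card_basis
    (Basis.piTensorProduct fun _ : Fin n => Module.finBasis k V)]
  simp

theorem finrank_range_map_le_s8 {k V : Type*} [Field k] [AddCommGroup V] [Module k V]
    [FiniteDimensional k V] (f : V →ₗ[k] V) (n : ℕ) :
    Module.finrank k (LinearMap.range (PiTensorProduct.map fun _ : Fin n => f)) ≤
      Module.finrank k (LinearMap.range f) ^ n := by
  have h : (PiTensorProduct.map fun _ : Fin n => f) =
      (PiTensorProduct.map fun _ : Fin n => (LinearMap.range f).subtype) ∘ₗ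
        PiTensorProduct.map fun _ : Fin n => f.rangeRestrict := by
    rw [← PiTensorProduct.map_comp]
    rfl
  rw [h, ← finrank_tensorPower]
  exact (Submodule.finrank_mono (LinearMap.range_comp_le_range _ _)).trans
    (LinearMap.finrank_range_le _)

end PiTensorProduct

namespace Representation

section Length

variable {k M W : Type*} [Field k] [Monoid M] [AddCommGroup W] [Module k W]

theorem coe_length_asModule (σ : Representation k M W) :
    (Module.length (MonoidAlgebra k M) σ.asModule : WithBot ℕ∞) =
      Order.krullDim σ.invtSubmodule := by
  rw [Module.coe_length]
  exact (Order.krullDim_eq_of_orderIso σ.mapSubmodule).symm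

theorem length_asModule_le_finrank [FiniteDimensional k W] (σ : Representation k M W) :
    Module.length (MonoidAlgebra k M) σ.asModule ≤ Module.finrank k W := by
  rw [← Module.length_eq_finrank, ← WithBot.coe_le_coe, coe_length_asModule, Module.coe_length]
  exact Order.krullDim_le_of_strictMono Subtype.val fun _ _ h => h

/-- If every non-identity element maps `W` into `U`, then every subspace containing `U` is
invariant, so the length of `W` is at least the dimension of `W ⧸ U`. -/
theorem finrank_quotient_le_length_asModule [FiniteDimensional k W] (σ : Representation k M W)
    (U : Submodule k W) (hU : ∀ m, m ≠ 1 → LinearMap.range (σ m) ≤ U) :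
    (Module.finrank k (W ⧸ U) : ℕ∞) ≤ Module.length (MonoidAlgebra k M) σ.asModule := by
  have hinv (P : Submodule k (W ⧸ U)) : P.comap U.mkQ ∈ σ.invtSubmodule := by
    rw [mem_invtSubmodule]
    intro m w hw
    rcases eq_or_ne m 1 with rfl | hm
    · simpa using hw
    · exact U.le_comap_mkQ P (hU m hm ⟨w, rfl⟩)
  rw [← Module.length_eq_finrank, ← WithBot.coe_le_coe, coe_length_asModule, Module.coe_length]
  exact Order.krullDim_le_of_strictMono (fun P => ⟨P.comap U.mkQ, hinv P⟩)
    (Submodule.comap_strictMono_of_surjective U.mkQ_surjective)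

end Length

/-- If a finite monoid has trivial units and only its identity acts as the identity, then only
its identity acts invertibly. -/
theorem eq_one_of_isUnit {k M V : Type*} [Field k] [Monoid M] [Finite M]
    [AddCommGroup V] [Module k V] (hG : ∀ u : Mˣ, u = 1) (ρ : Representation k M V)
    (hρ : ∀ m : M, ρ m = 1 → m = 1) {m : M} (hm : IsUnit (ρ m)) : m = 1 := by
  obtain ⟨i, j, hij, h⟩ : ∃ i j : ℕ, i < j ∧ m ^ i = m ^ j := by
    obtain ⟨i, j, hne, h⟩ := Finite.exists_ne_map_eq_of_infinite (fun i : ℕ => m ^ i)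
    rcases hne.lt_or_gt with hlt | hlt
    · exact ⟨i, j, hlt, h⟩
    · exact ⟨j, i, hlt, h.symm⟩
  have hpow : m ^ (j - i) = 1 := by
    apply hρ
    apply (hm.pow i).mul_left_cancel
    rw [← map_pow, ← map_mul, ← pow_add, Nat.add_sub_cancel' hij.le, ← h, mul_one]
  obtain ⟨u, rfl⟩ := IsUnit.of_pow_eq_one hpow (Nat.sub_ne_zero_of_lt hij)
  rw [hG u, Units.val_one]

theorem finrank_range_lt_of_not_isUnit {k V : Type*} [Field k] [AddCommGroup V] [Module k V]
    [FiniteDimensional k V] {f : Module.End k V} (hf : ¬ IsUnit f) :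
    Module.finrank k (LinearMap.range f) < Module.finrank k V := by
  rw [LinearMap.isUnit_iff_range_eq_top] at hf
  exact Submodule.finrank_lt hf

end Representation

/-- Let `k` be an algebraically closed field and `M` a finite monoid whose group of units
is trivial. Let `V` be a nonzero finite-dimensional `kM`-module such that `ρ(m) = id_V`
implies `m = 1`, and let `l(n)` be the composition-series length of `V^{⊗n}` over the
monoid algebra `k[M]`. Then `l(n)/(dim_k V)^n → 1` as `n → ∞`. -/
theorem tendsto_length_div_dim_pow_of_trivial_units
    {k M V : Type*} [Field k] [IsAlgClosed k] [Monoid M] [Fintype M]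
    (hG : ∀ u : Mˣ, u = 1)
    [AddCommGroup V] [Module k V] [FiniteDimensional k V] [Nontrivial V]
    (ρ : Representation k M V) (hρ : ∀ m : M, ρ m = 1 → m = 1)
    (l : ℕ → ℕ)
    (hl : ∀ n : ℕ, ∃ s : CompositionSeries
        (Submodule (MonoidAlgebra k M) ((ρ.tensorPower n).asModule)),
        s.head = ⊥ ∧ s.last = ⊤ ∧ s.length = l n) :
    Filter.Tendsto (fun n : ℕ => (l n : ℝ) / ((Module.finrank k V : ℝ) ^ n))
      Filter.atTop (nhds 1) := by
  set d := Module.finrank k V with hd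
  have hd0 : 0 < d := Module.finrank_pos
  have hlen (n : ℕ) :
      (l n : ℕ∞) = Module.length (MonoidAlgebra k M) (ρ.tensorPower n).asModule := by
    obtain ⟨s, hs, hs', hsl⟩ := hl n
    rw [← hsl]
    exact Module.length_compositionSeries s hs hs'
  have hupper (n : ℕ) : l n ≤ d ^ n := by
    have h := (ρ.tensorPower n).length_asModule_le_finrank
    rw [← hlen, PiTensorProduct.finrank_tensorPower] at h
    exact_mod_cast h
  have hrank (n : ℕ) (m : M) (hm : m ≠ 1) :
      Module.finrank k (LinearMap.range (ρ.tensorPower n m)) ≤ (d - 1) ^ n :=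
    (PiTensorProduct.finrank_range_map_le_s8 (ρ m) n).trans <| Nat.pow_le_pow_left
      (Nat.le_sub_one_of_lt <| Representation.finrank_range_lt_of_not_isUnit
        fun h => hm (ρ.eq_one_of_isUnit hG hρ h)) n
  have hlower (n : ℕ) : d ^ n ≤ l n + Fintype.card M * (d - 1) ^ n := by
    classical
    let U : Submodule k (⨂[k]^n V) :=
      (Finset.univ.filter fun m : M => m ≠ 1).sup fun m => LinearMap.range (ρ.tensorPower n m)
    have hU : Module.finrank k U ≤ Fintype.card M * (d - 1) ^ n := by
      refine (Submodule.finrank_finset_sup_le _ _).trans ?_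
      refine (Finset.sum_le_card_nsmul _ _ _ fun m hm => hrank n m (by simpa using hm)).trans ?_
      rw [smul_eq_mul]
      exact Nat.mul_le_mul_right _ (Finset.card_le_univ _)
    have h := (ρ.tensorPower n).finrank_quotient_le_length_asModule U fun m hm =>
      Finset.le_sup (f := fun m => LinearMap.range (ρ.tensorPower n m)) (by simpa using hm)
    rw [← hlen, Nat.cast_le] at h
    have hsum := U.finrank_quotient_add_finrank
    rw [PiTensorProduct.finrank_tensorPower, ← hd] at hsum
    omega
  have hdR : (0 : ℝ) < d := by exact_mod_cast hd0
  have hlim : Filter.Tendsto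
      (fun n : ℕ => 1 - (Fintype.card M : ℝ) * (((d - 1 : ℕ) : ℝ) / d) ^ n)
      Filter.atTop (nhds 1) := by
    have h := tendsto_pow_atTop_nhds_zero_of_lt_one (r := ((d - 1 : ℕ) : ℝ) / d) (by positivity)
      (by rw [div_lt_one hdR]; exact_mod_cast Nat.sub_one_lt hd0.ne')
    simpa using (h.const_mul (Fintype.card M : ℝ)).const_sub 1
  refine tendsto_of_tendsto_of_tendsto_of_le_of_le hlim tendsto_const_nhds (fun n => ?_) fun n => ?_
  · have h : (d : ℝ) ^ n ≤ l n + Fintype.card M * ((d - 1 : ℕ) : ℝ) ^ n := by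
      exact_mod_cast hlower n
    have hdn : (0 : ℝ) < (d : ℝ) ^ n := by positivity
    simp only [div_pow]
    rw [le_div_iff₀ hdn, sub_mul, mul_assoc, div_mul_cancel₀ _ hdn.ne']
    linarith
  · have h : (l n : ℝ) ≤ (d : ℝ) ^ n := by exact_mod_cast hupper n
    exact div_le_one_of_le₀ h (by positivity)

end
end
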